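/- Fix a prime number p and let ℤ[1/p]/ℤ denote the quotient ℤ-module (Localization of ℤ away from p)/(image of ℤ). For every finitely generated abelian group M, Hom_ℤ(ℤ[1/p]/ℤ, M) = 0 and there is an isomorphism of abelian groups Ext¹_ℤ(ℤ[1/p]/ℤ, M) ≅ M^∧_p, the p-adic completion of M (the inverse limit of M/pⁿM). (This says that for finitely generated M the derived p-adic completion Λ_p M is the ordinary p-adic completion concentrated in degree 0.) -/

import Mathlib

open CategoryTheory

/-- The Prüfer `p`-group `ℤ[1/p]/ℤ`: the quotient of the localization of `ℤ` away from `p`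
by the image of the canonical map from `ℤ`. -/
abbrev PruferQuot (p : ℕ) : Type :=
  Localization.Away (p : ℤ) ⧸
    (Int.castRingHom (Localization.Away (p : ℤ))).toAddMonoidHom.range

section

open Polynomial

/-- The inverse of `p` in `ℤ[1/p]`. -/
noncomputable def primeInv (p : ℕ) : Localization.Away (p : ℤ) :=
  IsLocalization.Away.invSelf (p : ℤ)

lemma algebraMap_mul_primeInv (p : ℕ) :
    algebraMap ℤ (Localization.Away (p : ℤ)) p * primeInv p = 1 :=
  IsLocalization.Away.mul_invSelf (p : ℤ)

/-- The relations of `ℤ[1/p]/ℤ` on the generators `1/pⁿ⁺¹`, with the `n`-th generator written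
as `Xⁿ`: the map `1 ↦ p`, `Xⁿ⁺¹ ↦ p Xⁿ⁺¹ - Xⁿ`. -/
noncomputable def relMap (p : ℕ) : ℤ[X] →ₗ[ℤ] ℤ[X] :=
  (p : ℤ) • LinearMap.id - (divX_hom (R := ℤ)).toIntLinearMap

/-- The presentation `Xⁿ ↦ 1/pⁿ⁺¹` of `ℤ[1/p]/ℤ` by generators. -/
noncomputable def augMap (p : ℕ) : ℤ[X] →ₗ[ℤ] PruferQuot p :=
  (((QuotientAddGroup.mk' _).comp (AddMonoidHom.mulLeft (primeInv p))).comp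
    (aeval (primeInv p)).toRingHom.toAddMonoidHom).toIntLinearMap

lemma relMap_apply (p : ℕ) (g : ℤ[X]) : relMap p g = C (p : ℤ) * g - divX g := by
  simp [relMap]

lemma augMap_apply (p : ℕ) (g : ℤ[X]) :
    augMap p g = QuotientAddGroup.mk (primeInv p * aeval (primeInv p) g) := rfl

lemma relMap_injective (p : ℕ) (hp : p ≠ 0) : Function.Injective (relMap p) := by
  rw [← LinearMap.ker_eq_bot, LinearMap.ker_eq_bot']
  intro g hg
  rw [relMap_apply, sub_eq_zero] at hg
  by_contra h
  have h2 := congrArg (coeff · g.natDegree) hg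
  simp [coeff_divX, hp, h] at h2

lemma augMap_surjective (p : ℕ) : Function.Surjective (augMap p) := by
  intro x
  obtain ⟨y, rfl⟩ := QuotientAddGroup.mk_surjective x
  obtain ⟨n, a, h⟩ := IsLocalization.Away.surj (p : ℤ) y
  refine ⟨C (p * a) * X ^ n, ?_⟩
  rw [augMap_apply]
  congr 1
  have h1 := algebraMap_mul_primeInv p
  set u := primeInv p
  simp only [map_mul, aeval_C, map_pow, aeval_X, ← h]
  have h3 := congrArg (· ^ n) h1
  simp only [mul_pow, one_pow] at h3
  linear_combination y * (algebraMap ℤ (Localization.Away (p : ℤ)) p * u) * h3 + y * h1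

lemma dvd_of_aeval_primeInv_eq_zero (p : ℕ) (g : ℤ[X]) (hg : aeval (primeInv p) g = 0) :
    C (p : ℤ) * X - 1 ∣ g := by
  rw [← AdjoinRoot.mk_eq_zero,
    ← map_eq_zero_iff _ (Localization.awayEquivAdjoin (p : ℤ)).symm.injective, ← hg]
  have h1 : (Localization.awayEquivAdjoin (p : ℤ)).symm.toAlgHom.comp
      (AdjoinRoot.mkₐ (C (p : ℤ) * X - 1)) = aeval (primeInv p) := by
    ext
    have h2 := congrArg (Localization.awayEquivAdjoin (p : ℤ)).symm (AdjoinRoot.root_isInv (p : ℤ))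
    rw [map_mul, map_one, mul_comm, ← AdjoinRoot.algebraMap_eq, AlgEquiv.commutes] at h2
    rw [aeval_X]
    exact left_inv_eq_right_inv h2 (algebraMap_mul_primeInv p)
  exact DFunLike.congr_fun h1 g

lemma exact_relMap_augMap (p : ℕ) : Function.Exact (relMap p) (augMap p) := by
  intro f
  have h1 := algebraMap_mul_primeInv p
  rw [augMap_apply, QuotientAddGroup.eq_zero_iff]
  constructor
  · rintro ⟨m, hm⟩
    obtain ⟨h, hh⟩ := dvd_of_aeval_primeInv_eq_zero p (X * f - C m) (by
      simp only [map_sub, map_mul, aeval_X, aeval_C, ← hm]; simp)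
    refine ⟨h, ?_⟩
    rw [relMap_apply]
    have h0 := X_mul_divX_add h
    have hc : h.coeff 0 = m := by
      have := congrArg (coeff · 0) hh
      simp [sub_mul, mul_assoc] at this
      exact this.symm
    have hX : X * (C (p : ℤ) * h - divX h) = X * f := by
      rw [hc] at h0
      linear_combination -h0 - hh
    exact mul_left_cancel₀ X_ne_zero hX
  · rintro ⟨g, rfl⟩
    refine ⟨g.coeff 0, ?_⟩
    have h0 := congrArg (aeval (primeInv p)) (X_mul_divX_add g)
    simp only [map_add, map_mul, aeval_X, aeval_C] at h0
    rw [relMap_apply]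
    simp only [map_sub, map_mul, aeval_C]
    have h2 := eq_intCast (algebraMap ℤ (Localization.Away (p : ℤ))) (g.coeff 0)
    rw [h2] at h0
    change ((g.coeff 0 : ℤ) : Localization.Away (p : ℤ)) = _
    linear_combination h0 - (aeval _ g) * h1

end

section

open Limits ZeroObject

variable {C : Type*} [Category* C] [Abelian C]

namespace CategoryTheory.ShortComplex

/-- The chain complex with `S.f : S.X₁ ⟶ S.X₂` in degrees `1` and `0`. -/
noncomputable def twoTerm (S : ShortComplex C) : ChainComplex C ℕ :=
  ChainComplex.of
    (fun n ↦ match n with | 0 => S.X₂ | 1 => S.X₁ | _ + 2 => 0)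
    (fun n ↦ match n with | 0 => S.f | _ + 1 => 0)
    (fun n ↦ match n with | 0 => zero_comp | _ + 1 => zero_comp)

lemma twoTerm_d (S : ShortComplex C) : S.twoTerm.d 1 0 = S.f := by
  simp [twoTerm, ChainComplex.of.d]

lemma isZero_twoTerm_X (S : ShortComplex C) (n : ℕ) : IsZero (S.twoTerm.X (n + 2)) := isZero_zero C

/-- The augmentation of `S.twoTerm` given by `S.g`. -/
noncomputable def twoTermπ (S : ShortComplex C) :
    S.twoTerm ⟶ (ChainComplex.single₀ C).obj S.X₃ :=
  (ChainComplex.toSingle₀Equiv _ _).symm ⟨S.g, by rw [twoTerm_d]; exact S.zero⟩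

lemma twoTermπ_f_zero (S : ShortComplex C) : S.twoTermπ.f 0 = S.g :=
  ChainComplex.toSingle₀Equiv_symm_apply_f_zero (C := S.twoTerm) S.g _

/-- A short exact sequence with `S.X₁` and `S.X₂` projective gives a projective resolution
of `S.X₃`. -/
noncomputable def ShortExact.projectiveResolution {S : ShortComplex C} (hS : S.ShortExact)
    [Projective S.X₁] [Projective S.X₂] : ProjectiveResolution S.X₃ where
  complex := S.twoTerm
  projective n := match n with
    | 0 => inferInstanceAs (Projective S.X₂)
    | 1 => inferInstanceAs (Projective S.X₁)
    | n + 2 => (S.isZero_twoTerm_X n).projective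
  π := S.twoTermπ
  quasiIso := ⟨fun n ↦ by
    match n with
    | 0 =>
      rw [ChainComplex.quasiIsoAt₀_iff, ShortComplex.quasiIso_iff_of_zeros' _ rfl rfl rfl]
      refine (ShortComplex.exact_and_epi_g_iff_of_iso ?_).2 ⟨hS.exact, hS.epi_g⟩
      exact ShortComplex.isoMk (Iso.refl _) (Iso.refl _) (Iso.refl _)
        ((Category.id_comp _).trans (S.twoTerm_d.symm.trans (Category.comp_id _).symm))
        ((Category.id_comp _).trans (S.twoTermπ_f_zero.symm.trans (Category.comp_id _).symm))
    | 1 =>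
      rw [quasiIsoAt_iff_exactAt' (hL := ChainComplex.exactAt_succ_single_obj ..),
        HomologicalComplex.exactAt_iff' _ 2 1 0 (by simp) (by simp),
        ShortComplex.exact_iff_mono _ ((S.isZero_twoTerm_X 0).eq_of_src _ _)]
      change Mono (S.twoTerm.d 1 0)
      rw [twoTerm_d]
      exact hS.mono_f
    | n + 2 =>
      rw [quasiIsoAt_iff_exactAt' (hL := ChainComplex.exactAt_succ_single_obj ..),
        HomologicalComplex.exactAt_iff]
      exact ShortComplex.exact_of_isZero_X₂ _ (S.isZero_twoTerm_X n)⟩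

end CategoryTheory.ShortComplex

end

/-- `Ext¹` out of an object with a projective resolution of length one is a cokernel. -/
lemma ext_one_equiv {R : Type*} [Ring R] {C : Type*} [Category* C] [Abelian C] [Linear R C]
    [EnoughProjectives C] {S : ShortComplex C} (hS : S.ShortExact)
    [Projective S.X₁] [Projective S.X₂] (Y : C) :
    Nonempty (((Ext R C 1).obj (Opposite.op S.X₃)).obj Y ≃ₗ[R]
      (S.X₁ ⟶ Y) ⧸ LinearMap.range (Linear.leftComp R Y S.f)) := by
  let K := S.twoTerm.linearYonedaObj R Y
  have hg : (K.sc' 0 1 2).g = 0 := by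
    ext (x : S.twoTerm.X 1 ⟶ Y)
    exact (S.isZero_twoTerm_X 0).eq_of_src _ _
  have hr : LinearMap.range (K.sc' 0 1 2).f.hom = LinearMap.range (Linear.leftComp R Y S.f) := by
    rw [← S.twoTerm_d]
    rfl
  have e₁ := hS.projectiveResolution.isoExt (R := R) 1 Y
  have e₂ : K.homology 1 ≅ (K.sc' 0 1 2).homology :=
    ShortComplex.homologyMapIso (K.isoSc' 0 1 2 (by simp) (by simp))
  have e₃ := (ShortComplex.LeftHomologyData.ofIsColimitCokernelCofork _ hg _
    (ModuleCat.cokernelIsColimit _)).homologyIso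
  have e := (e₁ ≪≫ e₂ ≪≫ e₃).toLinearEquiv
  exact ⟨e.trans (Submodule.quotEquivOfEq _ _ hr)⟩

section

variable {M : Type*} [AddCommGroup M]

open Finset

lemma mem_span_pow_smul_top (p n : ℕ) (x : M) :
    x ∈ ((Ideal.span {(p : ℤ)}) ^ n • ⊤ : Submodule ℤ M) ↔ ∃ z : M, p ^ n • z = x := by
  rw [Ideal.span_singleton_pow, Submodule.ideal_span_singleton_smul,
    Submodule.mem_smul_pointwise_iff_exists]
  simp only [Submodule.mem_top, true_and, ← Nat.cast_pow, natCast_zsmul]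

/-- The map sending a sequence `y` to the element `∑ pⁿ yₙ` of the `p`-adic completion. -/
noncomputable def powerSum (p : ℕ) (M : Type*) [AddCommGroup M] :
    (ℕ → M) →+ AdicCompletion (Ideal.span {(p : ℤ)}) M where
  toFun y := AdicCompletion.mk _ M (.mk _ M (fun n ↦ ∑ k ∈ range n, p ^ k • y k) fun n ↦ by
    rw [SModEq.sub_mem, mem_span_pow_smul_top]
    exact ⟨-y n, by simp [sum_range_succ]⟩)
  map_zero' := by ext n; simp
  map_add' x y := by
    ext n
    simp [sum_add_distrib, -map_sum, -Submodule.mkQ_apply]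

lemma powerSum_val (p : ℕ) (y : ℕ → M) (n : ℕ) :
    (powerSum p M y).val n = Submodule.Quotient.mk (∑ k ∈ range n, p ^ k • y k) := rfl

lemma powerSum_eq_zero_iff (p : ℕ) (y : ℕ → M) :
    powerSum p M y = 0 ↔ ∀ n, ∃ z : M, p ^ n • z = ∑ k ∈ range n, p ^ k • y k := by
  simp only [← mem_span_pow_smul_top, AdicCompletion.ext_iff, powerSum_val,
    AdicCompletion.val_zero_apply, Submodule.Quotient.mk_eq_zero]

lemma powerSum_surjective (p : ℕ) : Function.Surjective (powerSum p M) := by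
  intro a
  obtain ⟨⟨a, ha⟩, rfl⟩ := AdicCompletion.mk_surjective _ _ a
  have hy : ∀ n, ∃ y : M, p ^ n • y = a (n + 1) - a n := fun n ↦ by
    rw [← mem_span_pow_smul_top, ← SModEq.sub_mem]
    exact (ha n.le_succ).symm
  choose y hy using hy
  refine ⟨fun n ↦ if n = 0 then a 1 else y n, AdicCompletion.ext fun n ↦ ?_⟩
  change Submodule.Quotient.mk _ = Submodule.Quotient.mk (a n)
  rcases n with _ | n
  · exact (Submodule.Quotient.eq _).2 (by simp)
  · congr 1
    simp [sum_range_succ', hy, sum_range_sub (fun k ↦ a (k + 1))]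

/-- The `p`-power torsion of a finitely generated abelian group is bounded. -/
lemma exists_torsion_bound (p : ℕ) (M : Type*) [AddCommGroup M] [Module.Finite ℤ M] :
    ∃ N, ∀ k (x : M), p ^ k • x = 0 → p ^ N • x = 0 := by
  let f : M →ₗ[ℤ] M := LinearMap.lsmul ℤ M p
  have hf (n : ℕ) (x : M) : (f ^ n) x = p ^ n • x := by
    induction n with
    | zero => simp
    | succ n ih => simp [pow_succ', ih, f, mul_smul, smul_comm p]
  obtain ⟨N, hN⟩ := Filter.eventually_atTop.1 f.eventually_iSup_ker_pow_eq
  refine ⟨N, fun k x hx ↦ ?_⟩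
  rw [← hf, ← LinearMap.mem_ker] at hx ⊢
  rw [← hN N le_rfl]
  exact Submodule.mem_iSup_of_mem k hx

lemma powerSum_eq_zero_iff_exists (p : ℕ) [Module.Finite ℤ M] (y : ℕ → M) :
    powerSum p M y = 0 ↔ ∃ w : ℕ → M, w 0 = 0 ∧ ∀ n, p • w (n + 1) - w n = y n := by
  rw [powerSum_eq_zero_iff]
  constructor
  · intro hz
    choose z hz using hz
    obtain ⟨N, hN⟩ := exists_torsion_bound p M
    refine ⟨fun n ↦ p ^ N • z (n + N) - ∑ j ∈ range N, p ^ j • y (n + j), by simp [hz],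
      fun n ↦ ?_⟩
    have h1 : p ^ N • (p • z (n + N + 1) - z (n + N) - y (n + N)) = 0 := by
      refine hN (n + N) _ ?_
      rw [smul_sub, smul_sub, ← mul_smul, ← pow_succ, hz, hz, sum_range_succ]
      abel
    have h2 := sum_range_succ (fun j ↦ p ^ j • y (n + j)) N
    rw [sum_range_succ'] at h2
    simp only [smul_sub, smul_sum, ← mul_smul, ← pow_succ', ← pow_succ, pow_zero, one_smul,
      add_zero, add_right_comm n 1, ← add_assoc] at h1 h2 ⊢
    rw [← sub_eq_zero] at h2 ⊢
    rw [← sub_eq_zero.2 (h1.trans h2.symm)]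
    abel
  · rintro ⟨w, h0, hw⟩ n
    refine ⟨w n, ?_⟩
    have := sum_range_sub (fun k ↦ p ^ k • w k) n
    simpa [← hw, smul_sub, ← mul_smul, ← pow_succ, h0] using this.symm

end

section

open Polynomial

lemma relMap_monomial_zero (p : ℕ) : relMap p (monomial 0 1) = p • monomial 0 1 := by
  simp [relMap_apply]

lemma relMap_monomial_succ (p n : ℕ) :
    relMap p (monomial (n + 1) 1) = p • monomial (n + 1) 1 - monomial n 1 := by
  rw [relMap_apply, ← X_pow_eq_monomial, ← X_pow_eq_monomial, divX_X_pow]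
  simp

/-- The map sending `f` to `∑ pⁿ f(Xⁿ)`. -/
noncomputable def dualPowerSum (p : ℕ) (M : Type*) [AddCommGroup M] :
    (ℤ[X] →ₗ[ℤ] M) →+ AdicCompletion (Ideal.span {(p : ℤ)}) M :=
  (powerSum p M).comp
    { toFun f n := f (monomial n 1)
      map_zero' := rfl
      map_add' _ _ := rfl }

lemma dualPowerSum_apply (p : ℕ) {M : Type*} [AddCommGroup M] (f : ℤ[X] →ₗ[ℤ] M) :
    dualPowerSum p M f = powerSum p M fun n ↦ f (monomial n 1) := rfl

lemma exists_linearMap_monomial {M : Type*} [AddCommGroup M] (x : ℕ → M) :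
    ∃ f : ℤ[X] →ₗ[ℤ] M, ∀ n, f (monomial n 1) = x n :=
  ⟨(basisMonomials ℤ).constr ℤ x, fun n ↦ by
    simpa using (basisMonomials ℤ).constr_basis ℤ x n⟩

lemma dualPowerSum_surjective (p : ℕ) (M : Type*) [AddCommGroup M] :
    Function.Surjective (dualPowerSum p M) := fun a ↦ by
  obtain ⟨y, rfl⟩ := powerSum_surjective p a
  obtain ⟨f, hf⟩ := exists_linearMap_monomial y
  exact ⟨f, by simp [dualPowerSum_apply, hf]⟩

lemma dualPowerSum_eq_zero_iff (p : ℕ) {M : Type*} [AddCommGroup M] [Module.Finite ℤ M]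
    (f : ℤ[X] →ₗ[ℤ] M) :
    dualPowerSum p M f = 0 ↔ ∃ g : ℤ[X] →ₗ[ℤ] M, g ∘ₗ relMap p = f := by
  rw [dualPowerSum_apply, powerSum_eq_zero_iff_exists]
  constructor
  · rintro ⟨w, h0, hw⟩
    obtain ⟨g, hg⟩ := exists_linearMap_monomial fun n ↦ w (n + 1)
    refine ⟨g, (basisMonomials ℤ).ext fun n ↦ ?_⟩
    rw [coe_basisMonomials, ← hw]
    rcases n with _ | n
    · simp [relMap_monomial_zero, -monomial_zero_left, -nsmul_eq_mul, hg, h0]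
    · simp [relMap_monomial_succ, -nsmul_eq_mul, hg]
  · rintro ⟨g, rfl⟩
    refine ⟨fun n ↦ Nat.casesOn n 0 fun n ↦ g (monomial n 1), rfl, fun n ↦ ?_⟩
    rcases n with _ | n
    · simp [relMap_monomial_zero, -monomial_zero_left, -nsmul_eq_mul]
    · simp [relMap_monomial_succ, -nsmul_eq_mul]

lemma prufer_pow_torsion (p : ℕ) (x : PruferQuot p) : ∃ n, p ^ n • x = 0 := by
  obtain ⟨y, rfl⟩ := QuotientAddGroup.mk_surjective x
  obtain ⟨n, a, h⟩ := IsLocalization.Away.surj (p : ℤ) y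
  refine ⟨n, (QuotientAddGroup.eq_zero_iff _).2 ⟨a, ?_⟩⟩
  simp only [eq_intCast, Int.cast_natCast] at h
  change (a : Localization.Away (p : ℤ)) = p ^ n • y
  rw [← h, nsmul_eq_mul, mul_comm, Nat.cast_pow]

lemma prufer_pow_divisible (p n : ℕ) (x : PruferQuot p) : ∃ y, p ^ n • y = x := by
  obtain ⟨y, rfl⟩ := QuotientAddGroup.mk_surjective x
  have h := algebraMap_mul_primeInv p
  set u := primeInv p
  refine ⟨QuotientAddGroup.mk (u ^ n * y), ?_⟩
  simp only [eq_intCast, Int.cast_natCast] at h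
  change QuotientAddGroup.mk (p ^ n • (u ^ n * y)) = _
  rw [nsmul_eq_mul, Nat.cast_pow, ← mul_assoc, ← mul_pow, h, one_pow, one_mul]

lemma prufer_hom_eq_zero (p : ℕ) {M : Type*} [AddCommGroup M] [Module.Finite ℤ M]
    (f : PruferQuot p →ₗ[ℤ] M) : f = 0 := by
  obtain ⟨N, hN⟩ := exists_torsion_bound p M
  ext x
  obtain ⟨y, rfl⟩ := prufer_pow_divisible p N x
  obtain ⟨k, hk⟩ := prufer_pow_torsion p y
  rw [map_nsmul]
  exact hN k _ (by rw [← map_nsmul, hk, map_zero])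

/-- The free presentation `ℤ[X] ⟶ ℤ[X] ⟶ ℤ[1/p]/ℤ`. -/
noncomputable def pruferShortComplex (p : ℕ) : ShortComplex (ModuleCat.{0} ℤ) :=
  ShortComplex.mk (ModuleCat.ofHom (relMap p)) (ModuleCat.ofHom (augMap p)) (by
    rw [← ModuleCat.ofHom_comp, (exact_relMap_augMap p).linearMap_comp_eq_zero]
    rfl)

instance (p : ℕ) : Projective (pruferShortComplex p).X₁ :=
  ModuleCat.projective_of_free (basisMonomials ℤ)

instance (p : ℕ) : Projective (pruferShortComplex p).X₂ :=
  ModuleCat.projective_of_free (basisMonomials ℤ)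

lemma pruferShortComplex_shortExact (p : ℕ) (hp : p ≠ 0) :
    (pruferShortComplex p).ShortExact where
  exact := (ShortComplex.ShortExact.moduleCat_exact_iff_function_exact _).2 (exact_relMap_augMap p)
  mono_f := (ModuleCat.mono_iff_injective _).2 (relMap_injective p hp)
  epi_g := (ModuleCat.epi_iff_surjective _).2 (augMap_surjective p)

end

/-- For a finitely generated abelian group `M`, `Hom_ℤ(ℤ[1/p]/ℤ, M) = 0` and
`Ext¹_ℤ(ℤ[1/p]/ℤ, M)` is the `p`-adic completion of `M` (the inverse limit of `M/pⁿM`):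
the derived `p`-adic completion of `M` is the ordinary `p`-adic completion. -/
theorem derived_completion_of_fg (p : ℕ) [Fact p.Prime]
    (M : Type) [AddCommGroup M] [Module.Finite ℤ M] :
    (∀ f : PruferQuot p →ₗ[ℤ] M, f = 0) ∧
    Nonempty ((((Ext ℤ (ModuleCat ℤ) 1).obj
        (Opposite.op (ModuleCat.of ℤ (PruferQuot p)))).obj (ModuleCat.of ℤ M)) ≃+
      AdicCompletion (Ideal.span {(p : ℤ)}) M) := by
  refine ⟨prufer_hom_eq_zero p, ?_⟩
  have hp : p ≠ 0 := (Fact.out : p.Prime).ne_zero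
  have hS := pruferShortComplex_shortExact p hp
  obtain ⟨e⟩ := ext_one_equiv (R := ℤ) hS (ModuleCat.of ℤ M)
  let φ : ((pruferShortComplex p).X₁ ⟶ ModuleCat.of ℤ M) →ₗ[ℤ]
      AdicCompletion (Ideal.span {(p : ℤ)}) M :=
    { toFun f := dualPowerSum p M f.hom
      map_add' f g := map_add (dualPowerSum p M) f.hom g.hom
      map_smul' c f := map_zsmul (dualPowerSum p M) c f.hom }
  have hφ : Function.Surjective φ :=
    (dualPowerSum_surjective p M).comp ModuleCat.homEquiv.surjective
  have hker : LinearMap.range (Linear.leftComp ℤ (ModuleCat.of ℤ M) (pruferShortComplex p).f) =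
      LinearMap.ker φ := by
    ext f
    refine Iff.trans ?_ (dualPowerSum_eq_zero_iff p f.hom).symm
    exact ⟨fun ⟨g, hg⟩ ↦ ⟨g.hom, congrArg ModuleCat.Hom.hom hg⟩,
      fun ⟨g, hg⟩ ↦ ⟨ModuleCat.ofHom g, ModuleCat.hom_ext hg⟩⟩
  exact ⟨(e.trans ((Submodule.quotEquivOfEq _ _ hker).trans
    (φ.quotKerEquivOfSurjective hφ))).toAddEquiv⟩
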